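/- Let d ≥ 1 and let C be as in the context. The following conditions are equivalent: (i) there is μ > 0 such that ⟨ξ, C(x)ξ⟩ ≥ μ|ξ|² for almost every x ∈ ℝ^d and all ξ ∈ ℝ^d; (ii) there is μ > 0 such that h(φ) ≥ μ·l(φ) for every smooth compactly supported φ : ℝ^d → ℂ; (iii) there are μ > 0 and ν ≥ 0 such that h(φ) ≥ μ·l(φ) − ν·‖φ‖₂² for every smooth compactly supported φ : ℝ^d → ℂ. -/

import Mathlib

open MeasureTheory Matrix

/-- The quadratic form `h(φ) = ∑ᵢⱼ ∫ conj(∂ᵢφ) cᵢⱼ ∂ⱼφ` (its real value). -/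
noncomputable def formH (d : ℕ) (C : (Fin d → ℝ) → Matrix (Fin d) (Fin d) ℝ)
    (φ : (Fin d → ℝ) → ℂ) : ℝ :=
  ∑ i : Fin d, ∑ j : Fin d, ∫ x : Fin d → ℝ,
    ((starRingEnd ℂ) (fderiv ℝ φ x (Pi.single i 1)) * (C x i j : ℂ) *
      fderiv ℝ φ x (Pi.single j 1)).re

/-- The form `l(φ) = ∫ |∇φ|²` of the Laplacian. -/
noncomputable def formL (d : ℕ) (φ : (Fin d → ℝ) → ℂ) : ℝ :=
  ∫ x : Fin d → ℝ, ∑ i : Fin d, ‖fderiv ℝ φ x (Pi.single i 1)‖ ^ 2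

/-- A locally integrable function whose integrals against squares of test functions are
nonnegative is nonnegative almost everywhere. -/
theorem ae_nonneg_of_forall_integral_sq_mul_nonneg {E : Type*} [NormedAddCommGroup E]
    [NormedSpace ℝ E] [FiniteDimensional ℝ E] [MeasurableSpace E] [BorelSpace E]
    (m : Measure E) [m.IsAddHaarMeasure] (g : E → ℝ) (hg : LocallyIntegrable g m)
    (h : ∀ ψ : E → ℝ, ContDiff ℝ (⊤ : ℕ∞) ψ → HasCompactSupport ψ →
      0 ≤ ∫ x, ψ x ^ 2 * g x ∂m) :
    ∀ᵐ x ∂m, 0 ≤ g x := by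
  have hball : ∀ (x : E) (r : ℝ), 0 < r → 0 ≤ ∫ y in Metric.closedBall x r, g y ∂m := by
    intro x r hr
    let u : ℕ → ℝ := fun n => 1 / ((n : ℝ) + 1)
    have hu : ∀ n, 0 < u n := fun n => Nat.one_div_pos_of_nat
    have hu1 : ∀ n, u n ≤ 1 := fun n => by
      have : (0 : ℝ) ≤ n := n.cast_nonneg
      simp only [u]
      rw [div_le_one (by positivity)]
      linarith
    let b : ℕ → ContDiffBump x := fun n => ⟨r, r + u n, hr, by linarith [hu n]⟩
    have hlim : Filter.Tendsto (fun n => ∫ y, b n y ^ 2 * g y ∂m) Filter.atTop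
        (nhds (∫ y, (Metric.closedBall x r).indicator g y ∂m)) := by
      refine tendsto_integral_of_dominated_convergence
        (fun y => ‖(Metric.closedBall x (r + 1)).indicator g y‖) ?_ ?_ ?_ ?_
      · intro n
        exact (((b n).continuous.pow 2).aestronglyMeasurable).mul hg.aestronglyMeasurable
      · exact (((hg.integrableOn_isCompact (isCompact_closedBall x (r + 1))).integrable_indicator
          measurableSet_closedBall)).norm
      · intro n
        refine Filter.Eventually.of_forall fun y => ?_
        by_cases hy : y ∈ Metric.closedBall x (r + 1)
        · rw [Set.indicator_of_mem hy, norm_mul, norm_pow, Real.norm_eq_abs,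
            abs_of_nonneg (b n).nonneg]
          exact mul_le_of_le_one_left (norm_nonneg _)
            (pow_le_one₀ (b n).nonneg (b n).le_one)
        · have : b n y = 0 := by
            apply (b n).zero_of_le_dist
            simp only [Metric.mem_closedBall, not_le] at hy
            change r + u n ≤ dist y x
            linarith [hu1 n]
          simp [this]
      · refine Filter.Eventually.of_forall fun y => ?_
        by_cases hy : y ∈ Metric.closedBall x r
        · have : ∀ n, b n y = 1 := fun n => (b n).one_of_mem_closedBall hy
          simp [this, Set.indicator_of_mem hy]
        · rw [Set.indicator_of_notMem hy]
          refine tendsto_const_nhds.congr' ?_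
          simp only [Metric.mem_closedBall, not_le] at hy
          have h0 : Filter.Tendsto u Filter.atTop (nhds 0) :=
            tendsto_one_div_add_atTop_nhds_zero_nat
          filter_upwards [h0.eventually_lt_const (sub_pos.2 hy)] with n hn
          have : b n y = 0 := by
            apply (b n).zero_of_le_dist
            change r + u n ≤ dist y x
            linarith
          simp [this]
    rw [← integral_indicator measurableSet_closedBall]
    exact ge_of_tendsto' hlim fun n => h _ (b n).contDiff (b n).hasCompactSupport
  filter_upwards [IsUnifLocDoublingMeasure.ae_tendsto_average m hg 1] with x hx
  refine ge_of_tendsto (hx (l := nhdsWithin (0 : ℝ) (Set.Ioi 0)) (fun _ => x) id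
    Filter.tendsto_id ?_) ?_
  · filter_upwards [self_mem_nhdsWithin] with r hr
    simpa using (le_of_lt hr : (0 : ℝ) ≤ r)
  · filter_upwards [self_mem_nhdsWithin] with r hr
    rw [setAverage_eq]
    exact smul_nonneg (inv_nonneg.2 measureReal_nonneg) (hball x r hr)

/-- An essentially bounded measurable function times a continuous compactly supported one is
integrable. -/
theorem integrable_mul_of_ae_bounded {E : Type*} [TopologicalSpace E] [T2Space E]
    [MeasurableSpace E] [BorelSpace E] {m : Measure E} [IsFiniteMeasureOnCompacts m] {c f : E → ℝ}
    (hc : Measurable c) (hb : ∃ M : ℝ, ∀ᵐ x ∂m, |c x| ≤ M) (hf : Continuous f)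
    (hfs : HasCompactSupport f) : Integrable (fun x => c x * f x) m := by
  obtain ⟨M, hM⟩ := hb
  exact (hf.integrable_of_hasCompactSupport hfs).bdd_mul hc.aestronglyMeasurable (c := M)
    (by simpa using hM)

/-- The directional derivatives of a modulated real function. -/
theorem fderiv_ofReal_mul_cexp {E : Type*} [NormedAddCommGroup E] [NormedSpace ℝ E]
    {ψ : E → ℝ} {x : E} (hψ : DifferentiableAt ℝ ψ x) (L : E →L[ℝ] ℝ) (v : E) :
    fderiv ℝ (fun y => (ψ y : ℂ) * Complex.exp ((L y : ℂ) * Complex.I)) x v =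
      ((fderiv ℝ ψ x v : ℂ) + (L v * ψ x : ℝ) * Complex.I) *
        Complex.exp ((L x : ℂ) * Complex.I) := by
  have h1 : HasFDerivAt (fun y => (ψ y : ℂ)) (Complex.ofRealCLM.comp (fderiv ℝ ψ x)) x :=
    Complex.ofRealCLM.hasFDerivAt.comp x hψ.hasFDerivAt
  have h2 : HasFDerivAt (fun y => (L y : ℂ) * Complex.I)
      ((Complex.ofRealCLM.comp L).smulRight Complex.I) x :=
    ((Complex.ofRealCLM.comp L).smulRight Complex.I).hasFDerivAt
  have h3 : HasFDerivAt (fun y => (ψ y : ℂ) * Complex.exp ((L y : ℂ) * Complex.I)) _ x :=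
    h1.mul h2.cexp
  rw [h3.fderiv]
  simp
  ring

/-- The Rayleigh quotient bound extends from real to complex vectors. -/
theorem mul_sum_norm_sq_le_sum_re {ι : Type*} [Fintype ι] (A : Matrix ι ι ℝ) (μ : ℝ)
    (hA : ∀ ξ : ι → ℝ, μ * ∑ i, ξ i ^ 2 ≤ ξ ⬝ᵥ A.mulVec ξ) (z : ι → ℂ) :
    μ * ∑ i, ‖z i‖ ^ 2 ≤ ∑ i, ∑ j, ((starRingEnd ℂ) (z i) * (A i j : ℂ) * z j).re := by
  have h1 := hA fun i => (z i).re
  have h2 := hA fun i => (z i).im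
  have h3 : ∑ i, ‖z i‖ ^ 2 = ∑ i, (z i).re ^ 2 + ∑ i, (z i).im ^ 2 := by
    rw [← Finset.sum_add_distrib]
    refine Finset.sum_congr rfl fun i _ => ?_
    rw [← Complex.normSq_eq_norm_sq, Complex.normSq_apply]
    ring
  have h4 : ∑ i, ∑ j, ((starRingEnd ℂ) (z i) * (A i j : ℂ) * z j).re =
      (fun i => (z i).re) ⬝ᵥ A.mulVec (fun i => (z i).re) +
        (fun i => (z i).im) ⬝ᵥ A.mulVec (fun i => (z i).im) := by
    simp only [dotProduct, mulVec, Finset.mul_sum, ← Finset.sum_add_distrib]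
    refine Finset.sum_congr rfl fun i _ => Finset.sum_congr rfl fun j _ => ?_
    simp
    ring
  rw [h3, h4, mul_add]
  exact add_le_add h1 h2

/-- Pointwise ellipticity gives the corresponding form inequality. -/
theorem mul_formL_le_formH {d : ℕ} {C : (Fin d → ℝ) → Matrix (Fin d) (Fin d) ℝ}
    (hCmeas : ∀ i j, Measurable fun x => C x i j)
    (hCbdd : ∀ i j, ∃ M : ℝ, ∀ᵐ x : Fin d → ℝ, |C x i j| ≤ M) {μ : ℝ}
    (hC : ∀ᵐ x : Fin d → ℝ, ∀ ξ : Fin d → ℝ, μ * ∑ i, ξ i ^ 2 ≤ ξ ⬝ᵥ (C x).mulVec ξ)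
    {φ : (Fin d → ℝ) → ℂ} (hφ : ContDiff ℝ (⊤ : ℕ∞) φ) (hφs : HasCompactSupport φ) :
    μ * formL d φ ≤ formH d C φ := by
  have hcont : ∀ v, Continuous fun x => fderiv ℝ φ x v := fun v =>
    (hφ.continuous_fderiv (by simp)).clm_apply continuous_const
  have hsupp : ∀ v, HasCompactSupport fun x => fderiv ℝ φ x v := fun v => hφs.fderiv_apply ℝ v
  have hint : ∀ i j, Integrable fun x : Fin d → ℝ =>
      ((starRingEnd ℂ) (fderiv ℝ φ x (Pi.single i 1)) * (C x i j : ℂ) *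
        fderiv ℝ φ x (Pi.single j 1)).re := by
    intro i j
    have := integrable_mul_of_ae_bounded (m := volume) (hCmeas i j) (hCbdd i j)
      (f := fun x => ((starRingEnd ℂ) (fderiv ℝ φ x (Pi.single i 1)) *
        fderiv ℝ φ x (Pi.single j 1)).re)
      (Complex.continuous_re.comp
        ((Complex.continuous_conj.comp (hcont _)).mul (hcont _)))
      (((hsupp (Pi.single j 1)).mul_left).comp_left (g := Complex.re) rfl)
    refine this.congr (Filter.Eventually.of_forall fun x => ?_)
    simp
    ring
  have hintL : Integrable fun x : Fin d → ℝ => ∑ i, ‖fderiv ℝ φ x (Pi.single i 1)‖ ^ 2 := by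
    refine integrable_finsetSum _ fun i _ => Continuous.integrable_of_hasCompactSupport ?_ ?_
    · exact (hcont _).norm.pow 2
    · exact (hsupp (Pi.single i 1)).comp_left (g := fun z => ‖z‖ ^ 2) (by simp)
  have hH : formH d C φ = ∫ x : Fin d → ℝ, ∑ i, ∑ j,
      ((starRingEnd ℂ) (fderiv ℝ φ x (Pi.single i 1)) * (C x i j : ℂ) *
        fderiv ℝ φ x (Pi.single j 1)).re := by
    rw [integral_finsetSum _ fun i _ => integrable_finsetSum _ fun j _ => hint i j]
    exact Finset.sum_congr rfl fun i _ => (integral_finsetSum _ fun j _ => hint i j).symm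
  rw [hH, formL, ← integral_const_mul]
  refine integral_mono_ae (hintL.const_mul μ)
    (integrable_finsetSum _ fun i _ => integrable_finsetSum _ fun j _ => hint i j) ?_
  filter_upwards [hC] with x hx
  exact mul_sum_norm_sq_le_sum_re (C x) μ hx fun i => fderiv ℝ φ x (Pi.single i 1)

/-- If `a + t² b ≥ 0` for all real `t`, then `b ≥ 0`. -/
theorem nonneg_of_forall_add_sq_mul_nonneg {a b : ℝ} (h : ∀ t : ℝ, 0 ≤ a + t ^ 2 * b) :
    0 ≤ b := by
  by_contra! hb
  have h1 := h (Real.sqrt ((|a| + 1) / -b))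
  have hb' : 0 < -b := by linarith
  rw [Real.sq_sqrt (by positivity)] at h1
  have h2 : (|a| + 1) / -b * b = -(|a| + 1) := by
    have : b ≠ 0 := hb.ne
    field_simp
  linarith [le_abs_self a]

/-- The Gårding inequality, tested on highly oscillating functions. -/
theorem integral_sq_mul_nonneg_of_garding {d : ℕ}
    {C : (Fin d → ℝ) → Matrix (Fin d) (Fin d) ℝ}
    (hCmeas : ∀ i j, Measurable fun x => C x i j)
    (hCbdd : ∀ i j, ∃ M : ℝ, ∀ᵐ x : Fin d → ℝ, |C x i j| ≤ M) {μ ν : ℝ}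
    (hG : ∀ φ : (Fin d → ℝ) → ℂ, ContDiff ℝ (⊤ : ℕ∞) φ → HasCompactSupport φ →
      formH d C φ ≥ μ * formL d φ - ν * ∫ x : Fin d → ℝ, ‖φ x‖ ^ 2)
    (ξ : Fin d → ℝ) {ψ : (Fin d → ℝ) → ℝ} (hψ : ContDiff ℝ (⊤ : ℕ∞) ψ)
    (hψs : HasCompactSupport ψ) :
    0 ≤ ∫ x, ψ x ^ 2 * (ξ ⬝ᵥ (C x).mulVec ξ - μ * ∑ i, ξ i ^ 2) := by
  have hcont : ∀ v, Continuous fun x => fderiv ℝ ψ x v := fun v =>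
    (hψ.continuous_fderiv (by simp)).clm_apply continuous_const
  have hsupp : ∀ v, HasCompactSupport fun x => fderiv ℝ ψ x v := fun v => hψs.fderiv_apply ℝ v
  have hsq : HasCompactSupport fun x => ψ x ^ 2 := hψs.comp_left (g := fun z => z ^ 2) (by simp)
  have hsqc : Continuous fun x => ψ x ^ 2 := hψ.continuous.pow 2
  have hsqi : Integrable fun x => ψ x ^ 2 := hsqc.integrable_of_hasCompactSupport hsq
  have hint1 : ∀ i j, Integrable fun x : Fin d → ℝ => C x i j *
      (fderiv ℝ ψ x (Pi.single i 1) * fderiv ℝ ψ x (Pi.single j 1)) := fun i j =>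
    integrable_mul_of_ae_bounded (hCmeas i j) (hCbdd i j) ((hcont _).mul (hcont _))
      (hsupp _).mul_left
  have hint2 : ∀ i j, Integrable fun x : Fin d → ℝ => C x i j * ψ x ^ 2 := fun i j =>
    integrable_mul_of_ae_bounded (hCmeas i j) (hCbdd i j) hsqc hsq
  have hint3 : ∀ i, Integrable fun x : Fin d → ℝ => fderiv ℝ ψ x (Pi.single i 1) ^ 2 := by
    intro i
    refine Continuous.integrable_of_hasCompactSupport ?_ ?_
    · exact (hcont _).pow 2
    · exact (hsupp (Pi.single i 1)).comp_left (g := fun z => z ^ 2) (by simp)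
  have hmain : ∫ x, ψ x ^ 2 * (ξ ⬝ᵥ (C x).mulVec ξ - μ * ∑ i, ξ i ^ 2) =
      (∑ i, ∑ j, ξ i * ξ j * ∫ x, C x i j * ψ x ^ 2) -
        μ * ((∑ i, ξ i ^ 2) * ∫ x, ψ x ^ 2) := by
    have hpt : ∀ x, ψ x ^ 2 * (ξ ⬝ᵥ (C x).mulVec ξ - μ * ∑ i, ξ i ^ 2) =
        (∑ i, ∑ j, ξ i * ξ j * (C x i j * ψ x ^ 2)) - (μ * ∑ i, ξ i ^ 2) * ψ x ^ 2 := by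
      intro x
      simp only [dotProduct, mulVec, Finset.mul_sum, mul_sub, Finset.sum_mul]
      congr 1
      · refine Finset.sum_congr rfl fun i _ => Finset.sum_congr rfl fun j _ => ?_
        ring
      · refine Finset.sum_congr rfl fun i _ => ?_
        ring
    simp_rw [hpt]
    rw [integral_sub (integrable_finsetSum _ fun i _ => integrable_finsetSum _ fun j _ =>
      (hint2 i j).const_mul _) (hsqi.const_mul _), integral_const_mul, mul_assoc,
      integral_finsetSum _ fun i _ => integrable_finsetSum _ fun j _ => (hint2 i j).const_mul _]
    congr 1
    refine Finset.sum_congr rfl fun i _ => ?_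
    rw [integral_finsetSum _ fun j _ => (hint2 i j).const_mul _]
    exact Finset.sum_congr rfl fun j _ => integral_const_mul _ _
  rw [hmain]
  refine nonneg_of_forall_add_sq_mul_nonneg
    (a := (∑ i, ∑ j, ∫ x, C x i j *
      (fderiv ℝ ψ x (Pi.single i 1) * fderiv ℝ ψ x (Pi.single j 1))) -
      μ * (∑ i, ∫ x, fderiv ℝ ψ x (Pi.single i 1) ^ 2) + ν * ∫ x, ψ x ^ 2) fun t => ?_
  let L : (Fin d → ℝ) →L[ℝ] ℝ := ∑ i, (t * ξ i) • ContinuousLinearMap.proj i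
  have hL : ∀ i, L (Pi.single i 1) = t * ξ i := by
    intro i
    simp [L, Pi.single_apply]
  let φ : (Fin d → ℝ) → ℂ := fun y => (ψ y : ℂ) * Complex.exp ((L y : ℂ) * Complex.I)
  have hφ : ContDiff ℝ (⊤ : ℕ∞) φ :=
    (Complex.ofRealCLM.contDiff.comp hψ).mul
      (((Complex.ofRealCLM.contDiff.comp L.contDiff).mul contDiff_const).cexp)
  have hφs : HasCompactSupport φ :=
    HasCompactSupport.mul_right (hψs.comp_left (g := fun r : ℝ => (r : ℂ)) (by simp))
  have hexp : ∀ x, ‖Complex.exp ((L x : ℂ) * Complex.I)‖ = 1 := fun x =>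
    Complex.norm_exp_ofReal_mul_I _
  have hD : ∀ x i, fderiv ℝ φ x (Pi.single i 1) =
      ((fderiv ℝ ψ x (Pi.single i 1) : ℂ) + (t * ξ i * ψ x : ℝ) * Complex.I) *
        Complex.exp ((L x : ℂ) * Complex.I) := by
    intro x i
    rw [fderiv_ofReal_mul_cexp (hψ.differentiable (by simp) x) L, hL]
  have hN : ∫ x, ‖φ x‖ ^ 2 = ∫ x, ψ x ^ 2 := by
    refine integral_congr_ae (Filter.Eventually.of_forall fun x => ?_)
    simp only [φ, norm_mul, hexp, mul_one, Complex.norm_real, Real.norm_eq_abs, sq_abs]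
  have hLf : formL d φ = (∑ i, ∫ x, fderiv ℝ ψ x (Pi.single i 1) ^ 2) +
      t ^ 2 * ((∑ i, ξ i ^ 2) * ∫ x, ψ x ^ 2) := by
    have hpt : ∀ x i, ‖fderiv ℝ φ x (Pi.single i 1)‖ ^ 2 =
        fderiv ℝ ψ x (Pi.single i 1) ^ 2 + (t ^ 2 * ξ i ^ 2) * ψ x ^ 2 := by
      intro x i
      rw [hD, norm_mul, hexp, mul_one, ← Complex.normSq_eq_norm_sq, Complex.normSq_add_mul_I]
      ring
    have hint : ∀ i, Integrable fun x : Fin d → ℝ =>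
        fderiv ℝ ψ x (Pi.single i 1) ^ 2 + (t ^ 2 * ξ i ^ 2) * ψ x ^ 2 := fun i =>
      (hint3 i).add (hsqi.const_mul _)
    simp only [formL, hpt]
    rw [integral_finsetSum _ fun i _ => hint i, Finset.sum_mul, Finset.mul_sum, ← Finset.sum_add_distrib]
    refine Finset.sum_congr rfl fun i _ => ?_
    rw [integral_add (hint3 i) (hsqi.const_mul _), integral_const_mul]
    ring
  have hH : formH d C φ = (∑ i, ∑ j, ∫ x, C x i j *
      (fderiv ℝ ψ x (Pi.single i 1) * fderiv ℝ ψ x (Pi.single j 1))) +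
      t ^ 2 * ∑ i, ∑ j, ξ i * ξ j * ∫ x, C x i j * ψ x ^ 2 := by
    have hpt : ∀ x i j, ((starRingEnd ℂ) (fderiv ℝ φ x (Pi.single i 1)) * (C x i j : ℂ) *
        fderiv ℝ φ x (Pi.single j 1)).re =
        C x i j * (fderiv ℝ ψ x (Pi.single i 1) * fderiv ℝ ψ x (Pi.single j 1)) +
          (t ^ 2 * (ξ i * ξ j)) * (C x i j * ψ x ^ 2) := by
      intro x i j
      have he : (starRingEnd ℂ) (Complex.exp ((L x : ℂ) * Complex.I)) *
          Complex.exp ((L x : ℂ) * Complex.I) = 1 := by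
        rw [Complex.conj_mul', hexp]
        simp
      rw [hD, hD, map_mul]
      generalize Complex.exp ((L x : ℂ) * Complex.I) = e at he ⊢
      have hrw : ∀ z w : ℂ, (starRingEnd ℂ) z * (starRingEnd ℂ) e * (C x i j : ℂ) * (w * e) =
          (starRingEnd ℂ) z * (C x i j : ℂ) * w := fun z w => by
        linear_combination (starRingEnd ℂ) z * (C x i j : ℂ) * w * he
      rw [hrw]
      simp [-Complex.ofReal_mul]
      ring
    simp only [formH, hpt, Finset.mul_sum, ← Finset.sum_add_distrib]
    refine Finset.sum_congr rfl fun i _ => Finset.sum_congr rfl fun j _ => ?_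
    rw [integral_add (hint1 i j) ((hint2 i j).const_mul _), integral_const_mul]
    ring
  have := hG φ hφ hφs
  rw [hN, hLf, hH] at this
  linarith

/-- A Rayleigh quotient bound valid almost everywhere for each vector holds almost everywhere
for all vectors simultaneously. -/
theorem ae_forall_le_dotProduct_mulVec {α ι : Type*} [Fintype ι] [MeasurableSpace α]
    {m : Measure α} {C : α → Matrix ι ι ℝ} {μ : ℝ}
    (h : ∀ ξ : ι → ℝ, ∀ᵐ x ∂m, 0 ≤ ξ ⬝ᵥ (C x).mulVec ξ - μ * ∑ i, ξ i ^ 2) :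
    ∀ᵐ x ∂m, ∀ ξ : ι → ℝ, μ * ∑ i, ξ i ^ 2 ≤ ξ ⬝ᵥ (C x).mulVec ξ := by
  filter_upwards [ae_all_iff.2 fun n => h (TopologicalSpace.denseSeq (ι → ℝ) n)] with x hx ξ
  have hclosed : IsClosed {ξ : ι → ℝ | μ * ∑ i, ξ i ^ 2 ≤ ξ ⬝ᵥ (C x).mulVec ξ} :=
    isClosed_le (by fun_prop)
      (continuous_id.dotProduct (continuous_const.matrix_mulVec continuous_id))
  have hsub : Set.range (TopologicalSpace.denseSeq (ι → ℝ)) ⊆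
      {ξ : ι → ℝ | μ * ∑ i, ξ i ^ 2 ≤ ξ ⬝ᵥ (C x).mulVec ξ} := by
    rintro _ ⟨n, rfl⟩
    exact sub_nonneg.1 (hx n)
  exact hclosed.closure_subset_iff.2 hsub (TopologicalSpace.denseRange_denseSeq _ ξ)

/-- The quadratic form of an essentially bounded measurable matrix field is locally integrable. -/
theorem locallyIntegrable_dotProduct_mulVec_sub_const {d : ℕ}
    {C : (Fin d → ℝ) → Matrix (Fin d) (Fin d) ℝ}
    (hCmeas : ∀ i j, Measurable fun x => C x i j)
    (hCbdd : ∀ i j, ∃ M : ℝ, ∀ᵐ x : Fin d → ℝ, |C x i j| ≤ M) (ξ : Fin d → ℝ) (a : ℝ) :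
    LocallyIntegrable fun x => ξ ⬝ᵥ (C x).mulVec ξ - a := by
  have hC : ∀ i j, LocallyIntegrable fun x => C x i j := by
    intro i j
    obtain ⟨M, hM⟩ := hCbdd i j
    exact (locallyIntegrable_const M).mono (hCmeas i j).aestronglyMeasurable
      (hM.mono fun x hx => hx.trans (le_abs_self M))
  refine LocallyIntegrable.sub ?_ (locallyIntegrable_const a)
  simp only [dotProduct, mulVec, Finset.mul_sum]
  refine locallyIntegrable_finsetSum _ fun i _ => locallyIntegrable_finsetSum _ fun j _ => ?_
  refine ((hC i j).smul (ξ i * ξ j)).congr (Filter.Eventually.of_forall fun x => ?_)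
  simp
  ring

/-- Strong ellipticity `C ≥ μ I` a.e. is equivalent to the form bound `h ≥ μ l`,
and to the Gårding inequality `h ≥ μ l - ν ‖·‖₂²`. -/
theorem strong_ellipticity_tfae
    (d : ℕ) (hd : 1 ≤ d)
    (C : (Fin d → ℝ) → Matrix (Fin d) (Fin d) ℝ)
    (hCmeas : ∀ i j, Measurable fun x => C x i j)
    (hCsymm : ∀ᵐ x : Fin d → ℝ, (C x).IsSymm)
    (hCpos : ∀ᵐ x : Fin d → ℝ, ∀ ξ : Fin d → ℝ, 0 ≤ ξ ⬝ᵥ (C x).mulVec ξ)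
    (hCbdd : ∀ i j, ∃ M : ℝ, ∀ᵐ x : Fin d → ℝ, |C x i j| ≤ M) :
    List.TFAE
      [ ∃ μ : ℝ, 0 < μ ∧ ∀ᵐ x : Fin d → ℝ, ∀ ξ : Fin d → ℝ,
          μ * ∑ i : Fin d, ξ i ^ 2 ≤ ξ ⬝ᵥ (C x).mulVec ξ,
        ∃ μ : ℝ, 0 < μ ∧ ∀ φ : (Fin d → ℝ) → ℂ, ContDiff ℝ (⊤ : ℕ∞) φ → HasCompactSupport φ →
          formH d C φ ≥ μ * formL d φ,
        ∃ μ ν : ℝ, 0 < μ ∧ 0 ≤ ν ∧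
          ∀ φ : (Fin d → ℝ) → ℂ, ContDiff ℝ (⊤ : ℕ∞) φ → HasCompactSupport φ →
            formH d C φ ≥ μ * formL d φ - ν * ∫ x : Fin d → ℝ, ‖φ x‖ ^ 2 ] := by
  tfae_have 1 → 2 := by
    rintro ⟨μ, hμ, h⟩
    exact ⟨μ, hμ, fun φ hφ hφs => mul_formL_le_formH hCmeas hCbdd h hφ hφs⟩
  tfae_have 2 → 3 := by
    rintro ⟨μ, hμ, h⟩
    exact ⟨μ, 0, hμ, le_rfl, fun φ hφ hφs => by simpa using h φ hφ hφs⟩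
  tfae_have 3 → 1 := by
    rintro ⟨μ, ν, hμ, -, h⟩
    refine ⟨μ, hμ, ae_forall_le_dotProduct_mulVec fun ξ => ?_⟩
    exact ae_nonneg_of_forall_integral_sq_mul_nonneg volume _
      (locallyIntegrable_dotProduct_mulVec_sub_const hCmeas hCbdd ξ _)
      fun ψ hψ hψs => integral_sq_mul_nonneg_of_garding hCmeas hCbdd h ξ hψ hψs
  tfae_finish
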